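/- arXiv:0810.2799 — 2 statements merged into one kernel-verified Lean document; each statement's English description precedes it below -/
import Mathlib

section
/- The image under the toric moment map of the SO(6)-conjugation orbit of J₀⁻ = E₁₂ − E₃₄ + E₅₆ (the orbit parametrizing orthogonal almost complex structures inducing the opposite orientation of ℝ⁶) is the solid tetrahedron: {μ(P J₀⁻ Pᵀ) : P ∈ SO(6)} = {(x,y,z) ∈ ℝ³ : x+y+z ≤ 1, x−y−z ≤ 1, −x+y−z ≤ 1, −x−y+z ≤ 1}. -/
open Matrix

noncomputable section

/-- The skew-symmetric matrix of the 2-form `eⁱ ∧ eʲ`. -/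
def E (i j : Fin 6) : Matrix (Fin 6) (Fin 6) ℝ := fun k l =>
  (if k = j ∧ l = i then (1 : ℝ) else 0) - (if k = i ∧ l = j then (1 : ℝ) else 0)

/-- The orthogonal complex structure `J₀⁻ = E₁₂ − E₃₄ + E₅₆` inducing the
opposite orientation of `ℝ⁶`. -/
def J₀m : Matrix (Fin 6) (Fin 6) ℝ := E 0 1 - E 2 3 + E 4 5

/-- The toric moment map `μ(A) = (⟨Ae₁,e₂⟩, ⟨Ae₃,e₄⟩, ⟨Ae₅,e₆⟩)`. -/
def μ (A : Matrix (Fin 6) (Fin 6) ℝ) : ℝ × ℝ × ℝ := (A 1 0, A 3 2, A 5 4)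

/-- The Pfaffian of a skew-symmetric `6 × 6` matrix, in terms of the entries above the diagonal. -/
def pfaffian (B : Matrix (Fin 6) (Fin 6) ℝ) : ℝ :=
  B 0 1 * (B 2 3 * B 4 5 - B 2 4 * B 3 5 + B 2 5 * B 3 4)
    - B 0 2 * (B 1 3 * B 4 5 - B 1 4 * B 3 5 + B 1 5 * B 3 4)
    + B 0 3 * (B 1 2 * B 4 5 - B 1 4 * B 2 5 + B 1 5 * B 2 4)
    - B 0 4 * (B 1 2 * B 3 5 - B 1 3 * B 2 5 + B 1 5 * B 2 3)
    + B 0 5 * (B 1 2 * B 3 4 - B 1 3 * B 2 4 + B 1 4 * B 2 3)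

/-- The Pfaffian of the Gram matrix of an alternating form, as an alternating map. -/
def gramPfaffian (ω : LinearMap.BilinForm ℝ (Fin 6 → ℝ)) (hω : ω.IsAlt) :
    (Fin 6 → ℝ) [⋀^Fin 6]→ₗ[ℝ] ℝ where
  toFun v := pfaffian (of fun i j => ω (v i) (v j))
  map_update_add' := by
    intro inst v i x y
    obtain rfl : inst = instDecidableEqFin 6 := Subsingleton.elim _ _
    fin_cases i <;> simp [pfaffian, Function.update] <;> ring
  map_update_smul' := by
    intro inst v i c x
    obtain rfl : inst = instDecidableEqFin 6 := Subsingleton.elim _ _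
    fin_cases i <;> simp [pfaffian, Function.update] <;> ring
  map_eq_zero_of_eq' v i j hv hij := by
    have hneg : ∀ k l, ω (v l) (v k) = -ω (v k) (v l) := fun k l =>
      (LinearMap.IsAlt.neg hω _ _).symm
    wlog hlt : i < j generalizing i j
    · exact this j i hv.symm hij.symm (lt_of_le_of_ne (not_lt.mp hlt) hij.symm)
    fin_cases i <;> fin_cases j <;> first
      | exact absurd hlt (by decide)
      | (simp only [Fin.reduceFinMk, Fin.zero_eta, Fin.mk_one] at hv
         simp only [pfaffian, of_apply, hv, hω.self_eq_zero, hneg 1 2, hneg 1 3, hneg 2 3,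
           hneg 1 4, hneg 2 4, hneg 3 4, hneg 1 5, hneg 2 5, hneg 3 5, hneg 4 5]
         ring)

theorem pfaffian_conj {B : Matrix (Fin 6) (Fin 6) ℝ} (hB : (toBilin' B).IsAlt)
    (M : Matrix (Fin 6) (Fin 6) ℝ) : pfaffian (M * B * Mᵀ) = M.det * pfaffian B := by
  have hgram : ∀ N : Matrix (Fin 6) (Fin 6) ℝ,
      gramPfaffian (toBilin' B) hB N = pfaffian (N * B * Nᵀ) := fun N => by
    change pfaffian (of fun i j => toBilin' B (N i) (N j)) = _
    congr 1
    ext i j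
    rw [of_apply, toBilin'_apply', dotProduct_mulVec, mul_apply]
    rfl
  have hone : (⇑(Pi.basisFun ℝ (Fin 6)) : Fin 6 → Fin 6 → ℝ) =
      (1 : Matrix (Fin 6) (Fin 6) ℝ) := by
    ext i j
    simp [Pi.single_apply, one_apply, eq_comm]
  have h : pfaffian (M * B * Mᵀ) = pfaffian (1 * B * 1ᵀ) * M.det :=
    (hgram M).symm.trans <| (DFunLike.congr_fun
      ((gramPfaffian (toBilin' B) hB).eq_smul_basis_det (Pi.basisFun ℝ (Fin 6))) M).trans <|
        congrArg₂ (· * ·) ((congrArg _ hone).trans (hgram 1)) (Pi.basisFun_det_apply M)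
  rwa [transpose_one, Matrix.one_mul, Matrix.mul_one, mul_comm] at h

/-- The complementary Pfaffian minors of a skew-symmetric orthogonal matrix are its entries times
its Pfaffian. -/
theorem pfaffian_minor_eq {A : Matrix (Fin 6) (Fin 6) ℝ} (hskew : Aᵀ = -A) (hA : A * Aᵀ = 1) :
    A 2 3 * A 4 5 - A 2 4 * A 3 5 + A 2 5 * A 3 4 = pfaffian A * A 0 1 ∧
    A 0 1 * A 4 5 - A 0 4 * A 1 5 + A 0 5 * A 1 4 = pfaffian A * A 2 3 ∧
    A 0 1 * A 2 3 - A 0 2 * A 1 3 + A 0 3 * A 1 2 = pfaffian A * A 4 5 := by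
  have hs : ∀ i j, A j i = -A i j := fun i j => congrFun (congrFun hskew i) j
  have hd : ∀ i, A i i = 0 := fun i => by linarith [hs i i]
  have horth : ∀ i j, ∑ k, A i k * A j k = (1 : Matrix (Fin 6) (Fin 6) ℝ) i j := fun i j => by
    rw [← hA, mul_apply]; rfl
  simp only [Fin.sum_univ_six, one_apply] at horth
  rw [pfaffian]
  refine ⟨?_, ?_, ?_⟩
  · have o1 := horth 1 1
    have o2 := horth 1 2
    have o3 := horth 1 3
    have o4 := horth 1 4
    have o5 := horth 1 5
    simp only [hd, hs 0 1, hs 0 2, hs 1 2, hs 0 3, hs 1 3, hs 2 3,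
      hs 0 4, hs 1 4, hs 2 4, hs 3 4, hs 0 5, hs 1 5, hs 2 5, hs 3 5, hs 4 5,
      Fin.reduceEq, if_true, if_false] at o1 o2 o3 o4 o5
    linear_combination
      - (A 2 3 * A 4 5 - A 2 4 * A 3 5 + A 2 5 * A 3 4) * o1
      + (A 1 3 * A 4 5 - A 1 4 * A 3 5 + A 1 5 * A 3 4) * o2
      - (A 1 2 * A 4 5 - A 1 4 * A 2 5 + A 1 5 * A 2 4) * o3
      + (A 1 2 * A 3 5 - A 1 3 * A 2 5 + A 1 5 * A 2 3) * o4
      - (A 1 2 * A 3 4 - A 1 3 * A 2 4 + A 1 4 * A 2 3) * o5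
  · have o0 := horth 3 0
    have o1 := horth 3 1
    have o3 := horth 3 3
    have o4 := horth 3 4
    have o5 := horth 3 5
    simp only [hd, hs 0 1, hs 0 3, hs 1 3, hs 2 3,
      hs 0 4, hs 1 4, hs 2 4, hs 3 4, hs 0 5, hs 1 5, hs 2 5, hs 3 5, hs 4 5,
      Fin.reduceEq, if_true, if_false] at o0 o1 o3 o4 o5
    linear_combination
      - (A 1 3 * A 4 5 - A 1 4 * A 3 5 + A 1 5 * A 3 4) * o0
      + (A 0 3 * A 4 5 - A 0 4 * A 3 5 + A 0 5 * A 3 4) * o1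
      - (A 0 1 * A 4 5 - A 0 4 * A 1 5 + A 0 5 * A 1 4) * o3
      + (A 0 1 * A 3 5 - A 0 3 * A 1 5 + A 0 5 * A 1 3) * o4
      - (A 0 1 * A 3 4 - A 0 3 * A 1 4 + A 0 4 * A 1 3) * o5
  · have o0 := horth 5 0
    have o1 := horth 5 1
    have o2 := horth 5 2
    have o3 := horth 5 3
    have o5 := horth 5 5
    simp only [hd, hs 0 1, hs 0 2, hs 1 2, hs 0 3, hs 1 3, hs 2 3,
      hs 0 5, hs 1 5, hs 2 5, hs 3 5, hs 4 5,
      Fin.reduceEq, if_true, if_false] at o0 o1 o2 o3 o5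
    linear_combination
      - (A 1 2 * A 3 5 - A 1 3 * A 2 5 + A 1 5 * A 2 3) * o0
      + (A 0 2 * A 3 5 - A 0 3 * A 2 5 + A 0 5 * A 2 3) * o1
      - (A 0 1 * A 3 5 - A 0 3 * A 1 5 + A 0 5 * A 1 3) * o2
      + (A 0 1 * A 2 5 - A 0 2 * A 1 5 + A 0 5 * A 1 2) * o3
      - (A 0 1 * A 2 3 - A 0 2 * A 1 3 + A 0 3 * A 1 2) * o5

theorem nonneg_of_mul_nonneg_of_sum_pos {a b c d : ℝ} (hab : 0 ≤ a * b) (hac : 0 ≤ a * c)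
    (had : 0 ≤ a * d) (hsum : 0 < a + b + c + d) : 0 ≤ a := by
  refine nonneg_of_mul_nonneg_left (b := a + b + c + d) ?_ hsum
  nlinarith [mul_self_nonneg a]

theorem forall_nonneg_of_mul_nonneg_of_sum_pos {a b c d : ℝ} (hab : 0 ≤ a * b) (hac : 0 ≤ a * c)
    (had : 0 ≤ a * d) (hbc : 0 ≤ b * c) (hbd : 0 ≤ b * d) (hcd : 0 ≤ c * d)
    (hsum : 0 < a + b + c + d) : 0 ≤ a ∧ 0 ≤ b ∧ 0 ≤ c ∧ 0 ≤ d :=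
  ⟨nonneg_of_mul_nonneg_of_sum_pos hab hac had hsum,
    nonneg_of_mul_nonneg_of_sum_pos (mul_comm a b ▸ hab) hbc hbd (by linarith),
    nonneg_of_mul_nonneg_of_sum_pos (mul_comm a c ▸ hac) (mul_comm b c ▸ hbc) hcd (by linarith),
    nonneg_of_mul_nonneg_of_sum_pos (mul_comm a d ▸ had) (mul_comm b d ▸ hbd)
      (mul_comm c d ▸ hcd) (by linarith)⟩

/-- Up to a factor `4`, the barycentric coordinates of the moment map are the squared moduli of the
homogeneous coordinates of a point of `ℂP³`. In particular their pairwise products are sums of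
squares. -/
theorem tetrahedron_of_skew {A : Matrix (Fin 6) (Fin 6) ℝ} (hskew : Aᵀ = -A) (hA : A * Aᵀ = 1)
    (hpf : pfaffian A = 1) :
    A 1 0 + A 3 2 + A 5 4 ≤ 1 ∧ A 1 0 - A 3 2 - A 5 4 ≤ 1 ∧
    -A 1 0 + A 3 2 - A 5 4 ≤ 1 ∧ -A 1 0 - A 3 2 + A 5 4 ≤ 1 := by
  obtain ⟨m₁, m₂, m₃⟩ := pfaffian_minor_eq hskew hA
  rw [hpf, one_mul] at m₁ m₂ m₃
  have hs : ∀ i j, A j i = -A i j := fun i j => congrFun (congrFun hskew i) j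
  have hd : ∀ i, A i i = 0 := fun i => by linarith [hs i i]
  have horth : ∀ i, ∑ k, A i k * A i k = 1 := fun i => by
    rw [← one_apply_eq (α := ℝ) i, ← hA, mul_apply]; rfl
  simp only [Fin.sum_univ_six] at horth
  have o0 := horth 0
  have o1 := horth 1
  have o2 := horth 2
  have o3 := horth 3
  have o4 := horth 4
  have o5 := horth 5
  simp only [hd, hs 0 1, hs 0 2, hs 1 2, hs 0 3, hs 1 3, hs 2 3,
    hs 0 4, hs 1 4, hs 2 4, hs 3 4, hs 0 5, hs 1 5, hs 2 5, hs 3 5, hs 4 5] at o0 o1 o2 o3 o4 o5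
  rw [hs 0 1, hs 2 3, hs 4 5]
  have h01 : 0 ≤ (1 + A 0 1 + A 2 3 + A 4 5) * (1 + A 0 1 - A 2 3 - A 4 5) := by
    have h : 0 ≤ (A 2 4 - A 3 5) ^ 2 + (A 2 5 + A 3 4) ^ 2 := by positivity
    linear_combination h + (o2 + o3 + o4 + o5 - o0 - o1) / 2 + 2 * m₁
  have h23 : 0 ≤ (1 - A 0 1 + A 2 3 - A 4 5) * (1 - A 0 1 - A 2 3 + A 4 5) := by
    have h : 0 ≤ (A 2 4 + A 3 5) ^ 2 + (A 2 5 - A 3 4) ^ 2 := by positivity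
    linear_combination h + (o2 + o3 + o4 + o5 - o0 - o1) / 2 - 2 * m₁
  have h02 : 0 ≤ (1 + A 0 1 + A 2 3 + A 4 5) * (1 - A 0 1 + A 2 3 - A 4 5) := by
    have h : 0 ≤ (A 0 4 - A 1 5) ^ 2 + (A 0 5 + A 1 4) ^ 2 := by positivity
    linear_combination h + (o0 + o1 + o4 + o5 - o2 - o3) / 2 + 2 * m₂
  have h13 : 0 ≤ (1 + A 0 1 - A 2 3 - A 4 5) * (1 - A 0 1 - A 2 3 + A 4 5) := by
    have h : 0 ≤ (A 0 4 + A 1 5) ^ 2 + (A 0 5 - A 1 4) ^ 2 := by positivity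
    linear_combination h + (o0 + o1 + o4 + o5 - o2 - o3) / 2 - 2 * m₂
  have h03 : 0 ≤ (1 + A 0 1 + A 2 3 + A 4 5) * (1 - A 0 1 - A 2 3 + A 4 5) := by
    have h : 0 ≤ (A 0 2 - A 1 3) ^ 2 + (A 0 3 + A 1 2) ^ 2 := by positivity
    linear_combination h + (o0 + o1 + o2 + o3 - o4 - o5) / 2 + 2 * m₃
  have h12 : 0 ≤ (1 + A 0 1 - A 2 3 - A 4 5) * (1 - A 0 1 + A 2 3 - A 4 5) := by
    have h : 0 ≤ (A 0 2 + A 1 3) ^ 2 + (A 0 3 - A 1 2) ^ 2 := by positivity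
    linear_combination h + (o0 + o1 + o2 + o3 - o4 - o5) / 2 - 2 * m₃
  obtain ⟨h0, h1, h2, h3⟩ :=
    forall_nonneg_of_mul_nonneg_of_sum_pos h01 h02 h03 h12 h13 h23 (by linarith)
  refine ⟨?_, ?_, ?_, ?_⟩ <;> linarith

theorem J₀m_eq : J₀m =
    !![0, -1, 0, 0, 0, 0; 1, 0, 0, 0, 0, 0; 0, 0, 0, 1, 0, 0;
      0, 0, -1, 0, 0, 0; 0, 0, 0, 0, 0, -1; 0, 0, 0, 0, 1, 0] := by
  ext i j
  fin_cases i <;> fin_cases j <;> simp [J₀m, E]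

theorem J₀m_transpose : J₀mᵀ = -J₀m := by
  rw [J₀m_eq]
  ext i j
  fin_cases i <;> fin_cases j <;> simp

theorem J₀m_mul_transpose : J₀m * J₀mᵀ = 1 := by
  rw [J₀m_eq]
  ext i j
  fin_cases i <;> fin_cases j <;> simp [mul_apply, Fin.sum_univ_six]

theorem J₀m_isAlt : (toBilin' J₀m).IsAlt := fun v => by
  rw [toBilin'_apply', J₀m_eq]
  simp [dotProduct, mulVec, Fin.sum_univ_six]
  ring

theorem pfaffian_J₀m : pfaffian J₀m = 1 := by
  simp [pfaffian, J₀m_eq]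

/-- The rotation of `ℝ⁶` which acts on `⟨e₁, e₃, e₅⟩` as the quaternion `a + bi + cj + dk` and
trivially on `⟨e₂, e₄, e₆⟩`. -/
def quaternionRotation (a b c d : ℝ) : Matrix (Fin 6) (Fin 6) ℝ :=
  !![a ^ 2 + b ^ 2 - c ^ 2 - d ^ 2, 0, 2 * (b * c - a * d), 0, 2 * (b * d + a * c), 0;
    0, 1, 0, 0, 0, 0;
    2 * (b * c + a * d), 0, a ^ 2 - b ^ 2 + c ^ 2 - d ^ 2, 0, 2 * (c * d - a * b), 0;
    0, 0, 0, 1, 0, 0;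
    2 * (b * d - a * c), 0, 2 * (c * d + a * b), 0, a ^ 2 - b ^ 2 - c ^ 2 + d ^ 2, 0;
    0, 0, 0, 0, 0, 1]

theorem quaternionRotation_mul_transpose {a b c d : ℝ}
    (h : a ^ 2 + b ^ 2 + c ^ 2 + d ^ 2 = 1) :
    quaternionRotation a b c d * (quaternionRotation a b c d)ᵀ = 1 := by
  ext i j
  rw [mul_apply, Fin.sum_univ_six]
  fin_cases i <;> fin_cases j <;> simp [quaternionRotation] <;> first
    | ring1
    | linear_combination (a ^ 2 + b ^ 2 + c ^ 2 + d ^ 2 + 1) * h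

theorem det_quaternionRotation {a b c d : ℝ} (h : a ^ 2 + b ^ 2 + c ^ 2 + d ^ 2 = 1) :
    (quaternionRotation a b c d).det = 1 := by
  simp [quaternionRotation, det_succ_row_zero, Fin.sum_univ_succ, Fin.succAbove]
  linear_combination ((a ^ 2 + b ^ 2 + c ^ 2 + d ^ 2) ^ 2 +
    (a ^ 2 + b ^ 2 + c ^ 2 + d ^ 2) + 1) * h

theorem μ_quaternionRotation (a b c d : ℝ) :
    μ (quaternionRotation a b c d * J₀m * (quaternionRotation a b c d)ᵀ) =
      (a ^ 2 + b ^ 2 - c ^ 2 - d ^ 2, -(a ^ 2 - b ^ 2 + c ^ 2 - d ^ 2),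
        a ^ 2 - b ^ 2 - c ^ 2 + d ^ 2) := by
  simp [μ, mul_apply, Fin.sum_univ_six, J₀m_eq, quaternionRotation]

/-- The image under the toric moment map of the `SO(6)`-conjugation orbit of `J₀⁻`
is the solid tetrahedron `Δ_{𝒫⁻}`. -/
theorem moment_image_orbit_J₀m :
    {p : ℝ × ℝ × ℝ | ∃ P : Matrix (Fin 6) (Fin 6) ℝ,
        P * Pᵀ = 1 ∧ P.det = 1 ∧ p = μ (P * J₀m * Pᵀ)} =
    {p : ℝ × ℝ × ℝ |
        p.1 + p.2.1 + p.2.2 ≤ 1 ∧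
        p.1 - p.2.1 - p.2.2 ≤ 1 ∧
        -p.1 + p.2.1 - p.2.2 ≤ 1 ∧
        -p.1 - p.2.1 + p.2.2 ≤ 1} := by
  ext ⟨x, y, z⟩
  constructor
  · rintro ⟨P, hP, hdet, hμ⟩
    simp only [μ, Prod.mk.injEq] at hμ
    obtain ⟨rfl, rfl, rfl⟩ := hμ
    have hP' : Pᵀ * P = 1 := mul_eq_one_comm.mp hP
    refine tetrahedron_of_skew (A := P * J₀m * Pᵀ) ?_ ?_ ?_
    · simp [transpose_mul, J₀m_transpose, Matrix.mul_assoc]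
    · calc P * J₀m * Pᵀ * (P * J₀m * Pᵀ)ᵀ = P * (J₀m * (Pᵀ * P) * J₀mᵀ) * Pᵀ := by
            simp only [transpose_mul, transpose_transpose, Matrix.mul_assoc]
        _ = 1 := by rw [hP', Matrix.mul_one, J₀m_mul_transpose, Matrix.mul_one, hP]
    · rw [pfaffian_conj J₀m_isAlt, hdet, pfaffian_J₀m, one_mul]
  · rintro ⟨h₁, h₂, h₃, h₄⟩
    dsimp only at h₁ h₂ h₃ h₄
    have ha := Real.sq_sqrt (show 0 ≤ (1 + x - y + z) / 4 by linarith)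
    have hb := Real.sq_sqrt (show 0 ≤ (1 + x + y - z) / 4 by linarith)
    have hc := Real.sq_sqrt (show 0 ≤ (1 - x - y - z) / 4 by linarith)
    have hd := Real.sq_sqrt (show 0 ≤ (1 - x + y + z) / 4 by linarith)
    have hnorm : √((1 + x - y + z) / 4) ^ 2 + √((1 + x + y - z) / 4) ^ 2 +
        √((1 - x - y - z) / 4) ^ 2 + √((1 - x + y + z) / 4) ^ 2 = 1 := by
      rw [ha, hb, hc, hd]
      ring
    refine ⟨_, quaternionRotation_mul_transpose hnorm, det_quaternionRotation hnorm, ?_⟩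
    rw [μ_quaternionRotation, ha, hb, hc, hd]
    ext <;> dsimp only <;> ring
end
end

section
/- The set of orthogonal complex structures on the Iwasawa Lie algebra compatible with the standard orientation is the disjoint union of a single point and a 2-sphere: a matrix A in the SO(6)-conjugation orbit of J₀ has vanishing Nijenhuis tensor, N_A(X,Y) = [AX,AY] − [X,Y] − A[AX,Y] − A[X,AY] = 0 for all X,Y ∈ ℝ⁶ (where the brackets are the Iwasawa Lie brackets), if and only if either A = J₀ or A = a(E₁₂−E₃₄) + b(E₁₃+E₂₄) + c(E₁₄−E₂₃) − E₅₆ for some a, b, c ∈ ℝ with a² + b² + c² = 1. In particular μ maps this set onto the union of the vertex (1,1,1) and the opposite edge {(a,−a,−1) : −1 ≤ a ≤ 1} of the moment tetrahedron. -/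
open Matrix

noncomputable section

/-- The standard orthogonal complex structure `J₀ = E₁₂ + E₃₄ + E₅₆`. -/
def J₀ : Matrix (Fin 6) (Fin 6) ℝ := E 0 1 + E 2 3 + E 4 5

/-- The 2-step nilpotent Lie bracket of the Iwasawa Lie algebra on `ℝ⁶`:
`[e₁,e₃] = e₅`, `[e₄,e₂] = e₅`, `[e₁,e₄] = e₆`, `[e₂,e₃] = e₆`, all brackets
taking values in the centre `span{e₅,e₆}`. -/
def br (X Y : Fin 6 → ℝ) : Fin 6 → ℝ :=
  ![0, 0, 0, 0,
    X 0 * Y 2 - X 2 * Y 0 + X 3 * Y 1 - X 1 * Y 3,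
    X 0 * Y 3 - X 3 * Y 0 + X 1 * Y 2 - X 2 * Y 1]

/-- `A` lies in the `SO(6)`-conjugation orbit of `J₀`. -/
def InOrbitJ₀ (A : Matrix (Fin 6) (Fin 6) ℝ) : Prop :=
  ∃ P : Matrix (Fin 6) (Fin 6) ℝ, P * Pᵀ = 1 ∧ P.det = 1 ∧ A = P * J₀ * Pᵀ

/-- The Nijenhuis tensor of `A` with respect to the Iwasawa brackets vanishes. -/
def NijenhuisZero (A : Matrix (Fin 6) (Fin 6) ℝ) : Prop :=
  ∀ X Y : Fin 6 → ℝ,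
    br (A *ᵥ X) (A *ᵥ Y) - br X Y - A *ᵥ br (A *ᵥ X) Y - A *ᵥ br X (A *ᵥ Y) = 0

lemma pfaffian_eq_zero_of_rows_eq (B : Matrix (Fin 6) (Fin 6) ℝ) (hB : ∀ k l, B k l = -B l k)
    {i j : Fin 6} (hij : i ≠ j) (h : ∀ k, B i k = B j k) : pfaffian B = 0 := by
  have hc : ∀ k, B k i = B k j := fun k => by rw [hB k i, hB k j, h]
  have hd : ∀ k, B k k = 0 := fun k => by linarith [hB k k]
  have h1 := hB 1 0
  have h2 := hB 2 0
  have h3 := hB 3 0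
  have h4 := hB 4 0
  have h6 := hB 2 1
  have h7 := hB 3 1
  have h8 := hB 4 1
  have h9 := hB 5 1
  have h10 := hB 3 2
  have h11 := hB 4 2
  have h12 := hB 5 2
  have h13 := hB 4 3
  have h14 := hB 5 3
  have h15 := hB 5 4
  unfold pfaffian
  clear hB
  fin_cases i <;> fin_cases j <;>
    first
    | exact absurd rfl hij
    | (simp only [Fin.zero_eta, Fin.mk_one, Fin.reduceFinMk] at h hc
       simp only [h, hc, hd, h1, h2, h3, h4, h6, h7, h8, h9, h10, h11, h12, h13, h14, h15]
       ring)

/-- The Pfaffian of the Gram matrix of a skew form, as an alternating map of the vectors. -/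
def pfaffianAlternating (J : Matrix (Fin 6) (Fin 6) ℝ) (hJ : Jᵀ = -J) :
    (Fin 6 → ℝ) [⋀^Fin 6]→ₗ[ℝ] ℝ where
  toFun v := pfaffian (of fun i j => v i ⬝ᵥ J *ᵥ v j)
  map_update_add' := by
    intro inst v i x y
    obtain rfl : inst = instDecidableEqFin 6 := Subsingleton.elim _ _
    fin_cases i <;>
      simp [pfaffian, mulVec_add, add_dotProduct, dotProduct_add] <;> ring
  map_update_smul' := by
    intro inst v i c x
    obtain rfl : inst = instDecidableEqFin 6 := Subsingleton.elim _ _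
    fin_cases i <;>
      simp [pfaffian, mulVec_smul] <;> ring
  map_eq_zero_of_eq' v i j h hij := by
    refine pfaffian_eq_zero_of_rows_eq _ (fun k l => ?_) hij (fun k => by simp only [of_apply, h])
    rw [of_apply, of_apply, dotProduct_mulVec, ← mulVec_transpose, hJ, neg_mulVec, neg_dotProduct,
      dotProduct_comm]

lemma pfaffianAlternating_apply (J : Matrix (Fin 6) (Fin 6) ℝ) (hJ : Jᵀ = -J)
    (v : Fin 6 → Fin 6 → ℝ) :
    pfaffianAlternating J hJ v = pfaffian (of fun i j => v i ⬝ᵥ J *ᵥ v j) := rfl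

lemma pfaffian_conj_s16 (P J : Matrix (Fin 6) (Fin 6) ℝ) (hJ : Jᵀ = -J) :
    pfaffian (P * J * Pᵀ) = P.det * pfaffian J := by
  have hP : (of fun i j => P i ⬝ᵥ J *ᵥ P j) = P * J * Pᵀ := by
    ext i j
    rw [Matrix.mul_assoc]
    simp [mul_apply, dotProduct, mulVec]
  have hJ' : (of fun i j => Pi.basisFun ℝ (Fin 6) i ⬝ᵥ J *ᵥ Pi.basisFun ℝ (Fin 6) j) = J := by
    ext i j
    simp
  have hdet : (detRowAlternating fun i => P i) = P.det := by rw [det]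
  calc pfaffian (P * J * Pᵀ) = pfaffianAlternating J hJ fun i => P i := by
        rw [pfaffianAlternating_apply, hP]
    _ = (pfaffianAlternating J hJ (Pi.basisFun ℝ (Fin 6)) • detRowAlternating) fun i => P i := by
        rw [← Pi.basisFun_det, ← AlternatingMap.eq_smul_basis_det]
    _ = P.det * pfaffian J := by
        rw [AlternatingMap.smul_apply, pfaffianAlternating_apply, hJ', smul_eq_mul, hdet, mul_comm]

lemma J₀_eq : J₀ = !![0, -1, 0, 0, 0, 0; 1, 0, 0, 0, 0, 0; 0, 0, 0, -1, 0, 0;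
    0, 0, 1, 0, 0, 0; 0, 0, 0, 0, 0, -1; 0, 0, 0, 0, 1, 0] := by
  ext i j
  fin_cases i <;> fin_cases j <;> simp [J₀, E]

lemma sphere_eq (a b c : ℝ) :
    a • (E 0 1 - E 2 3) + b • (E 0 2 + E 1 3) + c • (E 0 3 - E 1 2) - E 4 5 =
      !![0, -a, -b, -c, 0, 0; a, 0, c, -b, 0, 0; b, -c, 0, a, 0, 0; c, b, -a, 0, 0, 0;
        0, 0, 0, 0, 0, 1; 0, 0, 0, 0, -1, 0] := by
  ext i j
  fin_cases i <;> fin_cases j <;> simp [E]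

lemma J₀_transpose : J₀ᵀ = -J₀ := by
  rw [J₀_eq]
  ext i j
  fin_cases i <;> fin_cases j <;> simp

lemma J₀_mul_self : J₀ * J₀ = -1 := by
  rw [J₀_eq]
  ext i j
  fin_cases i <;> fin_cases j <;> simp [mul_apply, Fin.sum_univ_six]

lemma pfaffian_J₀ : pfaffian J₀ = -1 := by
  simp [pfaffian, J₀, E]

lemma InOrbitJ₀.transpose_eq_neg {A : Matrix (Fin 6) (Fin 6) ℝ} (h : InOrbitJ₀ A) : Aᵀ = -A := by
  obtain ⟨P, -, -, rfl⟩ := h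
  simp [transpose_mul, J₀_transpose, Matrix.mul_assoc]

lemma InOrbitJ₀.mul_self {A : Matrix (Fin 6) (Fin 6) ℝ} (h : InOrbitJ₀ A) : A * A = -1 := by
  obtain ⟨P, hP, -, rfl⟩ := h
  have hP' : Pᵀ * P = 1 := mul_eq_one_comm.mp hP
  calc P * J₀ * Pᵀ * (P * J₀ * Pᵀ) = P * J₀ * (Pᵀ * P) * J₀ * Pᵀ := by
        simp only [Matrix.mul_assoc]
    _ = P * (J₀ * J₀) * Pᵀ := by rw [hP', Matrix.mul_one, Matrix.mul_assoc P]
    _ = -1 := by simp [J₀_mul_self, hP]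

lemma InOrbitJ₀.pfaffian_eq {A : Matrix (Fin 6) (Fin 6) ℝ} (h : InOrbitJ₀ A) :
    pfaffian A = -1 := by
  obtain ⟨P, -, hdet, rfl⟩ := h
  rw [pfaffian_conj_s16 P J₀ J₀_transpose, hdet, pfaffian_J₀, one_mul]

lemma nijenhuisZero_J₀ : NijenhuisZero J₀ := by
  intro X Y
  ext i
  simp only [J₀_eq, br, mulVec, dotProduct, Fin.sum_univ_six, Pi.sub_apply]
  fin_cases i <;> simp <;> ring

lemma nijenhuisZero_sphere {a b c : ℝ} (h : a ^ 2 + b ^ 2 + c ^ 2 = 1) :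
    NijenhuisZero
      (a • (E 0 1 - E 2 3) + b • (E 0 2 + E 1 3) + c • (E 0 3 - E 1 2) - E 4 5) := by
  intro X Y
  ext i
  simp only [sphere_eq, br, mulVec, dotProduct, Fin.sum_univ_six, Pi.sub_apply]
  fin_cases i <;> simp
  · linear_combination (X 0 * Y 2 - X 2 * Y 0 + X 3 * Y 1 - X 1 * Y 3) * h
  · linear_combination (X 0 * Y 3 - X 3 * Y 0 + X 1 * Y 2 - X 2 * Y 1) * h

lemma inOrbitJ₀_J₀ : InOrbitJ₀ J₀ := ⟨1, by simp, by simp, by simp⟩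

lemma inOrbitJ₀_circle {a b : ℝ} (h : a ^ 2 + b ^ 2 = 1) :
    InOrbitJ₀ (a • (E 0 1 - E 2 3) + b • (E 0 2 + E 1 3) + (0 : ℝ) • (E 0 3 - E 1 2) - E 4 5) := by
  rw [sphere_eq]
  refine ⟨!![1, 0, 0, 0, 0, 0; 0, a, 0, -b, 0, 0; 0, b, 0, a, 0, 0; 0, 0, 1, 0, 0, 0;
    0, 0, 0, 0, 1, 0; 0, 0, 0, 0, 0, -1], ?_, ?_, ?_⟩
  · ext i j
    fin_cases i <;> fin_cases j <;> simp [mul_apply, Fin.sum_univ_six] <;> linarith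
  · simp [det_succ_row_zero, Fin.sum_univ_succ, Fin.succAbove]
    linarith
  · rw [J₀_eq]
    ext i j
    fin_cases i <;> fin_cases j <;> simp [mul_apply, Fin.sum_univ_six]

lemma NijenhuisZero.basis {A : Matrix (Fin 6) (Fin 6) ℝ} (h : NijenhuisZero A) (i j k : Fin 6) :
    br (A.col i) (A.col j) k - br (Pi.single i 1) (Pi.single j 1) k
      - (A k 4 * br (A.col i) (Pi.single j 1) 4 + A k 5 * br (A.col i) (Pi.single j 1) 5)
      - (A k 4 * br (Pi.single i 1) (A.col j) 4 + A k 5 * br (Pi.single i 1) (A.col j) 5) = 0 := by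
  have hA : ∀ X Y, (A *ᵥ br X Y) k = A k 4 * br X Y 4 + A k 5 * br X Y 5 := fun X Y => by
    simp [mulVec, dotProduct, Fin.sum_univ_six, br]
  have := congrFun (h (Pi.single i 1) (Pi.single j 1)) k
  simpa only [mulVec_single_one, Pi.sub_apply, hA, Pi.zero_apply] using this

/-- An integrable complex structure preserves the centre. -/
lemma NijenhuisZero.apply_center {A : Matrix (Fin 6) (Fin 6) ℝ} (h : NijenhuisZero A)
    {j : Fin 6} (hj : 4 ≤ j) {k : Fin 6} (hk : k < 4) : A k j = 0 := by
  have hbr : ∀ X i, i < 4 → br X (Pi.single i 1) k = 0 ∧ br X (A.col i) k = 0 := by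
    intro X i _
    fin_cases k <;> first | exact absurd hk (by decide) | simp [br]
  have hz : ∀ Y l, br (Pi.single j 1) Y l = 0 := by
    intro Y l
    fin_cases j <;> first | exact absurd hj (by decide) | (fin_cases l <;> simp [br])
  have key : ∀ i, i < 4 → A k 4 * br (A.col j) (Pi.single i 1) 4
      + A k 5 * br (A.col j) (Pi.single i 1) 5 = 0 := by
    intro i hi
    have := h.basis j i k
    rw [(hbr _ i hi).1, (hbr _ i hi).2, hz, hz] at this
    linarith
  have hj' : j = 4 ∨ j = 5 := by omega
  have e0 := key 0 (by decide)
  have e1 := key 1 (by decide)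
  have e2 := key 2 (by decide)
  have e3 := key 3 (by decide)
  simp only [br, col_apply] at e0 e1 e2 e3
  simp at e0 e1 e2 e3
  have h01 : (A 0 j ^ 2 + A 1 j ^ 2) * A k j = 0 := by
    rcases hj' with rfl | rfl
    · linear_combination A 0 4 * e2 - A 1 4 * e3
    · linear_combination A 1 5 * e2 + A 0 5 * e3
  have h23 : (A 2 j ^ 2 + A 3 j ^ 2) * A k j = 0 := by
    rcases hj' with rfl | rfl
    · linear_combination A 3 4 * e1 - A 2 4 * e0
    · linear_combination -A 3 5 * e0 - A 2 5 * e1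
  by_contra hne
  have g01 := (mul_eq_zero.mp h01).resolve_right hne
  have g23 := (mul_eq_zero.mp h23).resolve_right hne
  have hpos := pow_pos (abs_pos.mpr hne) 2
  rw [sq_abs] at hpos
  fin_cases k <;> first | exact absurd hk (by decide) | skip
  all_goals
    simp only [Fin.zero_eta, Fin.mk_one, Fin.reduceFinMk] at hpos
    nlinarith [sq_nonneg (A 0 j), sq_nonneg (A 1 j), sq_nonneg (A 2 j), sq_nonneg (A 3 j)]

/-- A skew-symmetric matrix with a `4 + 2` block decomposition. -/
def skewBlock (p q r s t u e : ℝ) : Matrix (Fin 6) (Fin 6) ℝ :=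
  !![0, -p, -q, -r, 0, 0; p, 0, -s, -t, 0, 0; q, s, 0, -u, 0, 0; r, t, u, 0, 0, 0;
    0, 0, 0, 0, 0, -e; 0, 0, 0, 0, e, 0]

lemma exists_eq_skewBlock {A : Matrix (Fin 6) (Fin 6) ℝ} (hT : Aᵀ = -A) (hN : NijenhuisZero A) :
    ∃ p q r s t u e, A = skewBlock p q r s t u e := by
  have hT' : ∀ i j, A i j = -A j i := fun i j => by
    simpa using congrFun (congrFun hT j) i
  have hd : ∀ i, A i i = 0 := fun i => by linarith [hT' i i]
  have hc : ∀ k j, 4 ≤ j → k < 4 → A k j = 0 := fun k j hj hk => hN.apply_center hj hk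
  have hc' : ∀ k j, 4 ≤ j → k < 4 → A j k = 0 := fun k j hj hk => by
    rw [hT', hc k j hj hk, neg_zero]
  refine ⟨A 1 0, A 2 0, A 3 0, A 2 1, A 3 1, A 3 2, A 5 4, ?_⟩
  ext i j
  fin_cases i <;> fin_cases j <;> simp [skewBlock] <;>
    first
    | exact hd _
    | exact hT' _ _
    | exact hc _ _ (by decide) (by decide)
    | exact hc' _ _ (by decide) (by decide)

lemma NijenhuisZero.eq_one_of_selfDual {p q r : ℝ}
    (hN : NijenhuisZero (skewBlock p q r r (-q) p 1)) : p = 1 := by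
  have h1 := hN.basis 0 2 4
  have h2 := hN.basis 0 3 5
  simp [br, skewBlock] at h1 h2
  have h3 : (p - 1) ^ 2 = 0 := by linarith
  linarith [pow_eq_zero_iff two_ne_zero |>.mp h3]

lemma eq_of_orbit_of_nijenhuisZero {A : Matrix (Fin 6) (Fin 6) ℝ} (hA : InOrbitJ₀ A)
    (hN : NijenhuisZero A) :
    A = J₀ ∨ ∃ a b c : ℝ, a ^ 2 + b ^ 2 + c ^ 2 = 1 ∧
      A = a • (E 0 1 - E 2 3) + b • (E 0 2 + E 1 3) + c • (E 0 3 - E 1 2) - E 4 5 := by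
  obtain ⟨p, q, r, s, t, u, e, rfl⟩ := exists_eq_skewBlock hA.transpose_eq_neg hN
  have hpf := hA.pfaffian_eq
  have hsq : ∀ i, (skewBlock p q r s t u e * skewBlock p q r s t u e) i i = -1 := fun i => by
    rw [hA.mul_self]; simp
  have h0 := hsq 0
  have h1 := hsq 1
  have h2 := hsq 2
  have h3 := hsq 3
  have h4 := hsq 4
  simp [pfaffian, skewBlock, mul_apply, Fin.sum_univ_six] at hpf h0 h1 h2 h3 h4
  have he : (e - 1) * (e + 1) = 0 := by linarith
  rcases mul_eq_zero.mp he with he | he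
  · obtain rfl : e = 1 := by linarith
    have hsum : (u - p) ^ 2 + (t + q) ^ 2 + (s - r) ^ 2 = 0 := by linarith
    obtain rfl : u = p := by nlinarith [sq_nonneg (u - p), sq_nonneg (t + q), sq_nonneg (s - r)]
    obtain rfl : t = -q := by nlinarith [sq_nonneg (t + q), sq_nonneg (s - r)]
    obtain rfl : s = r := by nlinarith [sq_nonneg (s - r)]
    obtain rfl := hN.eq_one_of_selfDual
    have hq : q = 0 := by nlinarith [sq_nonneg q, sq_nonneg s]
    have hr : s = 0 := by nlinarith [sq_nonneg q, sq_nonneg s]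
    left
    rw [J₀_eq, hq, hr]
    simp [skewBlock]
  · obtain rfl : e = -1 := by linarith
    have hsum : (u + p) ^ 2 + (t - q) ^ 2 + (s + r) ^ 2 = 0 := by linarith
    obtain rfl : u = -p := by nlinarith [sq_nonneg (u + p), sq_nonneg (t - q), sq_nonneg (s + r)]
    obtain rfl : t = q := by nlinarith [sq_nonneg (t - q), sq_nonneg (s + r)]
    obtain rfl : s = -r := by nlinarith [sq_nonneg (s + r)]
    right
    refine ⟨p, t, r, by linarith, ?_⟩
    rw [sphere_eq]
    simp [skewBlock]

/-- The complex structures on the Iwasawa Lie algebra compatible with the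
standard orientation are a point plus a 2-sphere: `A` in the orbit of `J₀` has
vanishing Nijenhuis tensor iff `A = J₀` or
`A = a(E₁₂−E₃₄) + b(E₁₃+E₂₄) + c(E₁₄−E₂₃) − E₅₆` with `a² + b² + c² = 1`;
the moment image of this set is the vertex `(1,1,1)` together with the opposite
edge `{(a,−a,−1) : −1 ≤ a ≤ 1}` of the tetrahedron. -/
theorem iwasawa_complex_structures :
    (∀ A : Matrix (Fin 6) (Fin 6) ℝ, InOrbitJ₀ A →
      (NijenhuisZero A ↔
        (A = J₀ ∨ ∃ a b c : ℝ, a ^ 2 + b ^ 2 + c ^ 2 = 1 ∧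
          A = a • (E 0 1 - E 2 3) + b • (E 0 2 + E 1 3) + c • (E 0 3 - E 1 2) - E 4 5))) ∧
    {p : ℝ × ℝ × ℝ | ∃ A : Matrix (Fin 6) (Fin 6) ℝ,
        InOrbitJ₀ A ∧ NijenhuisZero A ∧ p = μ A} =
      insert ((1 : ℝ), (1 : ℝ), (1 : ℝ))
        {p : ℝ × ℝ × ℝ | ∃ a : ℝ, -1 ≤ a ∧ a ≤ 1 ∧ p = (a, -a, -1)} := by
  refine ⟨fun A hA => ⟨eq_of_orbit_of_nijenhuisZero hA, ?_⟩, ?_⟩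
  · rintro (rfl | ⟨a, b, c, h, rfl⟩)
    · exact nijenhuisZero_J₀
    · exact nijenhuisZero_sphere h
  · ext x
    simp only [Set.mem_ofPred_eq, Set.mem_insert_iff]
    constructor
    · rintro ⟨A, hA, hN, rfl⟩
      rcases eq_of_orbit_of_nijenhuisZero hA hN with rfl | ⟨a, b, c, h, rfl⟩
      · left
        simp [μ, J₀_eq]
      · refine Or.inr ⟨a, ?_, ?_, ?_⟩
        · nlinarith [sq_nonneg b, sq_nonneg c]
        · nlinarith [sq_nonneg b, sq_nonneg c]
        · rw [sphere_eq]
          simp [μ]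
    · rintro (rfl | ⟨a, h1, h2, rfl⟩)
      · exact ⟨J₀, inOrbitJ₀_J₀, nijenhuisZero_J₀, by simp [μ, J₀_eq]⟩
      · have h : a ^ 2 + √(1 - a ^ 2) ^ 2 = 1 := by
          rw [Real.sq_sqrt (by nlinarith)]
          ring
        refine ⟨_, inOrbitJ₀_circle h, nijenhuisZero_sphere (by linarith), ?_⟩
        rw [sphere_eq]
        simp [μ]
end
end
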